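/- The solution space of a second-order linear analytic ODE x'' + a₁(t)x' + a₂(t)x = 0 on an open interval I is a Chebyshev space (every nonzero solution has at most one zero counted with multiplicity) if and only if there exists a solution x₀ with x₀(t) ≠ 0 for all t ∈ I. -/

import Mathlib

/-- `f` has at most `l` zeros on `s`, counted with multiplicity: for any finite set of
points of `s` at which `f` vanishes together with its first `m x - 1` derivatives,
the total multiplicity is at most `l`. -/
def ZerosWithMultAtMost (f : ℝ → ℝ) (s : Set ℝ) (l : ℕ) : Prop :=
  ∀ (t : Finset ℝ) (m : ℝ → ℕ), (↑t : Set ℝ) ⊆ s →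
    (∀ x ∈ t, 1 ≤ m x ∧ ∀ k < m x, iteratedDeriv k f x = 0) →
    t.sum m ≤ l

open Filter Topology Set

noncomputable def odeCoeff (A B : ℕ → ℝ) (α β : ℝ) : ℕ → ℝ
  | 0 => α
  | 1 => β
  | n + 2 => -(∑ k : Fin (n + 1), (A k * ((n + 1 - k : ℕ) : ℝ) * odeCoeff A B α β (n + 1 - k)
      + B k * odeCoeff A B α β (n - k))) / ((n + 2 : ℝ) * (n + 1))
  decreasing_by all_goals omega

lemma odeCoeff_rec (A B : ℕ → ℝ) (α β : ℝ) (n : ℕ) :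
    ((n + 2 : ℝ) * (n + 1)) * odeCoeff A B α β (n + 2) =
      -(∑ k ∈ Finset.range (n + 1), (A k * ((n + 1 - k : ℕ) : ℝ) * odeCoeff A B α β (n + 1 - k)
      + B k * odeCoeff A B α β (n - k))) := by
  rw [odeCoeff, Finset.sum_range]
  field_simp

lemma odeCoeff_bound (A B : ℕ → ℝ) (α β M r : ℝ) (hM : 0 < M) (hr : 0 < r)
    (hA : ∀ k, |A k| ≤ M * r ^ k) (hB : ∀ k, |B k| ≤ M * r ^ k) :
    ∃ C σ : ℝ, 0 < σ ∧ ∀ n, |odeCoeff A B α β n| ≤ C * σ ^ n := by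
  set σ : ℝ := 2 * r + 4 * M + 1 with hσ
  have hσ1 : 1 ≤ σ := by linarith
  have hσ0 : 0 < σ := by linarith
  set C : ℝ := |α| + |β| with hC
  have hC0 : 0 ≤ C := by positivity
  refine ⟨C, σ, hσ0, fun n => ?_⟩
  induction n using Nat.strong_induction_on with
  | _ n ih =>
  match n, ih with
  | 0, _ => simp [odeCoeff, hC]
  | 1, _ =>
    simp only [odeCoeff, hC, pow_one]
    nlinarith [abs_nonneg α, abs_nonneg β]
  | n + 2, ih =>
    have hrk : ∀ k, r ^ k ≤ σ ^ k * (1 / 2) ^ k := by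
      intro k
      rw [← mul_pow]
      exact pow_le_pow_left₀ hr.le (by linarith) k
    have key : ∀ k ∈ Finset.range (n + 1),
        |A k * ((n + 1 - k : ℕ) : ℝ) * odeCoeff A B α β (n + 1 - k)
          + B k * odeCoeff A B α β (n - k)| ≤ (2 * M * (n + 1) * C * σ ^ (n + 1)) * (1 / 2) ^ k := by
      intro k hk
      have hk : k ≤ n := by simpa [Nat.lt_succ_iff] using hk
      have i1 := ih (n + 1 - k) (by omega)
      have i2 := ih (n - k) (by omega)
      have hcast : ((n + 1 - k : ℕ) : ℝ) ≤ n + 1 := by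
        exact_mod_cast Nat.sub_le (n + 1) k
      have e1 : σ ^ k * σ ^ (n + 1 - k) = σ ^ (n + 1) := by
        rw [← pow_add]; congr 1; omega
      have e2 : σ ^ k * σ ^ (n - k) = σ ^ n := by
        rw [← pow_add]; congr 1; omega
      have e3 : σ ^ n ≤ σ ^ (n + 1) := pow_le_pow_right₀ hσ1 (by omega)
      have t1 : |A k * ((n + 1 - k : ℕ) : ℝ) * odeCoeff A B α β (n + 1 - k)| ≤
          (M * (n + 1) * C * σ ^ (n + 1)) * (1 / 2) ^ k := by
        rw [abs_mul, abs_mul, Nat.abs_cast]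
        calc _ ≤ (M * (σ ^ k * (1 / 2) ^ k)) * (n + 1) * (C * σ ^ (n + 1 - k)) := by
              gcongr
              exact (hA k).trans (by gcongr; exact hrk k)
          _ = (M * (n + 1) * C * (σ ^ k * σ ^ (n + 1 - k))) * (1 / 2) ^ k := by ring
          _ = _ := by rw [e1]
      have t2 : |B k * odeCoeff A B α β (n - k)| ≤
          (M * (n + 1) * C * σ ^ (n + 1)) * (1 / 2) ^ k := by
        rw [abs_mul]
        calc _ ≤ (M * (σ ^ k * (1 / 2) ^ k)) * (C * σ ^ (n - k)) := by
              gcongr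
              exact (hB k).trans (by gcongr; exact hrk k)
          _ = (M * 1 * C * (σ ^ k * σ ^ (n - k))) * (1 / 2) ^ k := by ring
          _ ≤ _ := by
              rw [e2]
              gcongr
              linarith [(Nat.cast_nonneg n : (0:ℝ) ≤ n)]
      calc _ ≤ _ := abs_add_le _ _
        _ ≤ _ := add_le_add t1 t2
        _ = _ := by ring
    have hgeo : ∑ k ∈ Finset.range (n + 1), (1 / 2 : ℝ) ^ k ≤ 2 := by
      exact sum_geometric_two_le (n + 1)
    have hsum : |(n + 2 : ℝ) * (n + 1) * odeCoeff A B α β (n + 2)| ≤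
        (2 * M * (n + 1) * C * σ ^ (n + 1)) * 2 := by
      rw [odeCoeff_rec, abs_neg]
      refine (Finset.abs_sum_le_sum_abs _ _).trans ((Finset.sum_le_sum key).trans ?_)
      rw [← Finset.mul_sum]
      gcongr
    have hn0 : (0:ℝ) ≤ n := Nat.cast_nonneg n
    rw [abs_mul, abs_of_pos (by positivity : (0:ℝ) < (n + 2 : ℝ) * (n + 1))] at hsum
    have h2 : (2 * M * (n + 1) * C * σ ^ (n + 1)) * 2 ≤
        ((n + 2 : ℝ) * (n + 1)) * (C * σ ^ (n + 2)) := by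
      have : 4 * M * σ ^ (n + 1) ≤ σ ^ (n + 2) := by
        rw [pow_succ σ (n+1), mul_comm]
        gcongr
        linarith
      calc _ = (1 * (n + 1)) * (C * (4 * M * σ ^ (n + 1))) := by ring
        _ ≤ _ := by gcongr; linarith
    exact le_of_mul_le_mul_left (hsum.trans h2) (by positivity)

lemma analytic_coeff_bound {f : ℝ → ℝ} {t : ℝ} (h : AnalyticAt ℝ f t) :
    ∃ C r : ℝ, 0 < C ∧ 0 < r ∧ ∀ n, |iteratedDeriv n f t / (n.factorial : ℝ)| ≤ C * r ^ n := by
  have h1 := h.hasFPowerSeriesAt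
  obtain ⟨C, r, hC, hr, hb⟩ := FormalMultilinearSeries.le_mul_pow_of_radius_pos _ h1.radius_pos
  refine ⟨C, r, hC, hr, fun n => ?_⟩
  have := hb n
  rwa [FormalMultilinearSeries.ofScalars_norm, Real.norm_eq_abs] at this

lemma eventually_zero_of_iteratedDeriv {f : ℝ → ℝ} {t : ℝ} (h : AnalyticAt ℝ f t)
    (h0 : ∀ n, iteratedDeriv n f t = 0) : ∀ᶠ s in 𝓝 t, f s = 0 := by
  have h1 := h.hasFPowerSeriesAt
  have e : (fun n => iteratedDeriv n f t / (n.factorial : ℝ)) = (0 : ℕ → ℝ) := by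
    funext n; simp [h0]
  rw [e] at h1
  have e2 : FormalMultilinearSeries.ofScalars ℝ (0 : ℕ → ℝ) = 0 := by
    ext n : 1
    simp [FormalMultilinearSeries.ofScalars]
  rw [e2] at h1
  exact h1.eventually_eq_zero

lemma exists_analytic_of_bound (c : ℕ → ℝ) (C σ t : ℝ) (hσ : 0 < σ)
    (hc : ∀ n, |c n| ≤ C * σ ^ n) :
    ∃ x : ℝ → ℝ, AnalyticAt ℝ x t ∧ ∀ n, iteratedDeriv n x t = n.factorial * c n := by
  set q := FormalMultilinearSeries.ofScalars ℝ c with hq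
  have hrad : 0 < q.radius := by
    obtain ⟨ρ, hρ⟩ : ∃ ρ : NNReal, (ρ : ℝ) = σ⁻¹ := ⟨⟨σ⁻¹, by positivity⟩, rfl⟩
    have : (ρ : ENNReal) ≤ q.radius := by
      apply q.le_radius_of_bound C
      intro n
      rw [hq, FormalMultilinearSeries.ofScalars_norm, Real.norm_eq_abs]
      calc _ ≤ C * σ ^ n * σ⁻¹ ^ n := by
            rw [hρ]
            gcongr
            exact hc n
        _ = C := by rw [mul_assoc, ← mul_pow, mul_inv_cancel₀ hσ.ne']; simp
    refine lt_of_lt_of_le ?_ this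
    rw [ENNReal.coe_pos]
    have : (0 : ℝ) < ρ := by rw [hρ]; positivity
    exact_mod_cast this
  have h1 := (q.hasFPowerSeriesOnBall hrad).comp_sub t
  rw [zero_add] at h1
  have h2 : HasFPowerSeriesAt (fun z => q.sum (z - t)) q t := ⟨_, h1⟩
  refine ⟨_, h2.analyticAt, fun n => ?_⟩
  have h3 := h2.analyticAt.hasFPowerSeriesAt
  have h4 := h3.eq_formalMultilinearSeries h2
  have h5 := congrArg (fun p => FormalMultilinearSeries.coeff p n) h4
  simp only [FormalMultilinearSeries.coeff_ofScalars] at h5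
  have h6 : q.coeff n = c n := by rw [hq, FormalMultilinearSeries.coeff_ofScalars]
  rw [h6] at h5
  rw [← h5]
  field_simp

lemma local_sol {a₁ a₂ : ℝ → ℝ} {t₀ : ℝ} (h1 : AnalyticAt ℝ a₁ t₀) (h2 : AnalyticAt ℝ a₂ t₀)
    (α β : ℝ) : ∃ x : ℝ → ℝ, AnalyticAt ℝ x t₀ ∧ x t₀ = α ∧ deriv x t₀ = β ∧
      ∀ᶠ t in 𝓝 t₀, deriv (deriv x) t + a₁ t * deriv x t + a₂ t * x t = 0 := by
  obtain ⟨C₁, r₁, hC₁, hr₁, hb₁⟩ := analytic_coeff_bound h1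
  obtain ⟨C₂, r₂, hC₂, hr₂, hb₂⟩ := analytic_coeff_bound h2
  set A : ℕ → ℝ := fun n => iteratedDeriv n a₁ t₀ / (n.factorial : ℝ) with hA
  set B : ℕ → ℝ := fun n => iteratedDeriv n a₂ t₀ / (n.factorial : ℝ) with hB
  obtain ⟨C, σ, hσ, hbd⟩ := odeCoeff_bound A B α β (C₁ + C₂) (r₁ + r₂) (by positivity)
    (by positivity) (fun k => (hb₁ k).trans (by gcongr <;> linarith))
    (fun k => (hb₂ k).trans (by gcongr <;> linarith))
  obtain ⟨x, hx, hd⟩ := exists_analytic_of_bound _ C σ t₀ hσ hbd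
  refine ⟨x, hx, ?_, ?_, ?_⟩
  · simpa [odeCoeff] using hd 0
  · simpa [odeCoeff] using hd 1
  · apply eventually_zero_of_iteratedDeriv
      (f := fun t => deriv (deriv x) t + a₁ t * deriv x t + a₂ t * x t)
    · exact ((hx.deriv.deriv).add (h1.mul hx.deriv)).add (h2.mul hx)
    intro n
    have d1 : ∀ m, iteratedDeriv m (deriv x) t₀ = (m + 1).factorial * odeCoeff A B α β (m + 1) := by
      intro m; rw [← iteratedDeriv_succ', hd]
    have d2 : iteratedDeriv n (deriv (deriv x)) t₀ =
        (n + 2).factorial * odeCoeff A B α β (n + 2) := by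
      rw [← iteratedDeriv_succ', d1]
    rw [iteratedDeriv_fun_add ((hx.deriv.deriv).fun_add (h1.fun_mul hx.deriv)).contDiffAt
      (h2.fun_mul hx).contDiffAt,
      iteratedDeriv_fun_add (hx.deriv.deriv).contDiffAt (h1.fun_mul hx.deriv).contDiffAt,
      iteratedDeriv_fun_mul h1.contDiffAt hx.deriv.contDiffAt,
      iteratedDeriv_fun_mul h2.contDiffAt hx.contDiffAt, d2]
    have hrec := odeCoeff_rec A B α β n
    have hf : ((n + 2).factorial : ℝ) = n.factorial * ((n + 2 : ℝ) * (n + 1)) := by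
      rw [Nat.factorial_succ, Nat.factorial_succ]; push_cast; ring
    rw [hf, mul_assoc, hrec, add_assoc, ← Finset.sum_add_distrib, mul_neg, neg_add_eq_zero,
      Finset.mul_sum]
    apply Finset.sum_congr rfl
    intro k hk
    have hk : k ≤ n := by simpa [Nat.lt_succ_iff] using hk
    rw [d1, hd, Nat.cast_choose ℝ hk, show n - k + 1 = n + 1 - k by omega]
    have hf2 : ((n + 1 - k).factorial : ℝ) = ((n + 1 - k : ℕ) : ℝ) * (n - k).factorial := by
      rw [show n + 1 - k = (n - k) + 1 by omega, Nat.factorial_succ]; push_cast; ring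
    rw [hf2]
    simp only [hA, hB]
    have := Nat.factorial_ne_zero k
    have := Nat.factorial_ne_zero (n - k)
    field_simp

noncomputable def odeV (a₁ a₂ : ℝ → ℝ) (t : ℝ) (z : ℝ × ℝ) : ℝ × ℝ :=
  (z.2, -(a₁ t * z.2 + a₂ t * z.1))

lemma odeV_sub (a₁ a₂ : ℝ → ℝ) (t : ℝ) (z w : ℝ × ℝ) :
    odeV a₁ a₂ t z - odeV a₁ a₂ t w = odeV a₁ a₂ t (z - w) := by
  ext <;> simp [odeV]; ring

lemma odeV_bound {a₁ a₂ : ℝ → ℝ} {p q : ℝ} (h1 : ContinuousOn a₁ (Icc p q))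
    (h2 : ContinuousOn a₂ (Icc p q)) :
    ∃ K : NNReal, ∀ t ∈ Icc p q, ∀ z, ‖odeV a₁ a₂ t z‖ ≤ K * ‖z‖ := by
  obtain ⟨C₁, hC₁⟩ := isCompact_Icc.exists_bound_of_continuousOn h1
  obtain ⟨C₂, hC₂⟩ := isCompact_Icc.exists_bound_of_continuousOn h2
  refine ⟨⟨1 + |C₁| + |C₂|, by positivity⟩, fun t ht z => ?_⟩
  have b1 : |a₁ t| ≤ |C₁| := (hC₁ t ht).trans (le_abs_self _)
  have b2 : |a₂ t| ≤ |C₂| := (hC₂ t ht).trans (le_abs_self _)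
  have z1 : |z.1| ≤ ‖z‖ := norm_fst_le z
  have z2 : |z.2| ≤ ‖z‖ := norm_snd_le z
  have z0 := norm_nonneg z
  change _ ≤ (1 + |C₁| + |C₂|) * ‖z‖
  refine max_le ?_ ?_
  · simp only [odeV, Real.norm_eq_abs]
    nlinarith [abs_nonneg C₁, abs_nonneg C₂]
  · simp only [odeV, Real.norm_eq_abs, abs_neg]
    calc _ ≤ |a₁ t| * |z.2| + |a₂ t| * |z.1| := by
          rw [← abs_mul, ← abs_mul]; exact abs_add_le _ _
      _ ≤ |C₁| * ‖z‖ + |C₂| * ‖z‖ := by gcongr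
      _ ≤ _ := by nlinarith

lemma odeV_lip {a₁ a₂ : ℝ → ℝ} {K : NNReal} {t : ℝ}
    (h : ∀ z, ‖odeV a₁ a₂ t z‖ ≤ K * ‖z‖) : LipschitzWith K (odeV a₁ a₂ t) := by
  apply LipschitzWith.of_dist_le_mul
  intro z w
  rw [dist_eq_norm, dist_eq_norm, odeV_sub]
  exact h _

lemma odeV_uniq {a₁ a₂ : ℝ → ℝ} {p q c : ℝ} (h1 : ContinuousOn a₁ (Icc p q))
    (h2 : ContinuousOn a₂ (Icc p q)) (hc : c ∈ Ioo p q) {z w : ℝ → ℝ × ℝ}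
    (hz : ∀ t ∈ Ioo p q, HasDerivAt z (odeV a₁ a₂ t (z t)) t)
    (hw : ∀ t ∈ Ioo p q, HasDerivAt w (odeV a₁ a₂ t (w t)) t) (he : z c = w c) :
    EqOn z w (Ioo p q) := by
  obtain ⟨K, hK⟩ := odeV_bound h1 h2
  exact ODE_solution_unique_of_mem_Ioo (v := odeV a₁ a₂) (s := fun _ => univ) (K := K)
    (fun t ht => (odeV_lip (hK t (Ioo_subset_Icc_self ht))).lipschitzOnWith) hc
    (fun t ht => ⟨hz t ht, trivial⟩) (fun t ht => ⟨hw t ht, trivial⟩) he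

noncomputable def clampR (R y : ℝ) : ℝ := max (-R) (min y R)

lemma clampR_lip (R x y : ℝ) : |clampR R x - clampR R y| ≤ |x - y| := by
  unfold clampR
  refine (abs_max_sub_max_le_max _ _ _ _).trans ?_
  refine max_le (by simp) ?_
  refine (abs_min_sub_min_le_max _ _ _ _).trans ?_
  exact max_le le_rfl (by simp)

lemma clampR_le {R : ℝ} (hR : 0 ≤ R) (y : ℝ) : |clampR R y| ≤ R := by
  unfold clampR
  rw [abs_le]
  exact ⟨le_max_left _ _, max_le (by linarith) (min_le_right _ _)⟩

lemma clampR_eq {R y : ℝ} (h : |y| ≤ R) : clampR R y = y := by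
  unfold clampR
  rw [abs_le] at h
  rw [min_eq_left h.2, max_eq_right h.1]

lemma clampR_zero {R : ℝ} (hR : 0 ≤ R) : clampR R 0 = 0 := clampR_eq (by simpa)

lemma clampR_le' {R : ℝ} (hR : 0 ≤ R) (y : ℝ) : |clampR R y| ≤ |y| := by
  simpa [clampR_zero hR] using clampR_lip R y 0

noncomputable def clampV (R : ℝ) (z : ℝ × ℝ) : ℝ × ℝ := (clampR R z.1, clampR R z.2)

lemma exists_compact_sol {a₁ a₂ : ℝ → ℝ} {p q c : ℝ} (h1 : ContinuousOn a₁ (Icc p q))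
    (h2 : ContinuousOn a₂ (Icc p q)) (hc : c ∈ Ioo p q) (z₀ : ℝ × ℝ) :
    ∃ z : ℝ → ℝ × ℝ, z c = z₀ ∧ ∀ t ∈ Ioo p q, HasDerivAt z (odeV a₁ a₂ t (z t)) t := by
  obtain ⟨K, hK⟩ := odeV_bound h1 h2
  have hpq : p < q := hc.1.trans hc.2
  set R : ℝ := ‖z₀‖ * Real.exp (K * (q - p)) with hRdef
  have hR : 0 ≤ R := by positivity
  have cl1 : ∀ z w, ‖clampV R z - clampV R w‖ ≤ ‖z - w‖ := fun z w =>
    max_le ((clampR_lip R _ _).trans (norm_fst_le (z - w)))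
      ((clampR_lip R _ _).trans (norm_snd_le (z - w)))
  have cl2 : ∀ z, ‖clampV R z‖ ≤ R := fun z => max_le (clampR_le hR _) (clampR_le hR _)
  have cl3 : ∀ z, ‖clampV R z‖ ≤ ‖z‖ := fun z =>
    max_le ((clampR_le' hR _).trans (norm_fst_le z)) ((clampR_le' hR _).trans (norm_snd_le z))
  have cl4 : ∀ z, ‖z‖ ≤ R → clampV R z = z := fun z hz =>
    Prod.ext (clampR_eq ((norm_fst_le z).trans hz)) (clampR_eq ((norm_snd_le z).trans hz))
  set F : ℝ → ℝ × ℝ → ℝ × ℝ := fun t z => odeV a₁ a₂ t (clampV R z) with hF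
  have hFb : ∀ t ∈ Icc p q, ∀ z, ‖F t z‖ ≤ K * ‖z‖ := fun t ht z =>
    (hK t ht _).trans (by gcongr; exact cl3 z)
  have hPL : IsPicardLindelof F (tmin := p) (tmax := q) ⟨c, Ioo_subset_Icc_self hc⟩ z₀
      (⟨K * R * (q - p), by have := sub_pos.2 hpq; positivity⟩) 0 (⟨K * R, by positivity⟩) K := by
    refine ⟨fun t ht => LipschitzWith.lipschitzOnWith ?_, fun z _ => ?_, fun t ht z _ => ?_, ?_⟩
    · apply LipschitzWith.of_dist_le_mul
      intro z w
      rw [dist_eq_norm, dist_eq_norm, hF, odeV_sub]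
      exact (hK t ht _).trans (by gcongr; exact cl1 z w)
    · simp only [hF, odeV]
      fun_prop
    · exact (hK t ht _).trans (by change _ ≤ K * R; gcongr; exact cl2 z)
    · change K * R * max (q - c) (c - p) ≤ K * R * (q - p) - 0
      rw [sub_zero]
      gcongr
      exact max_le (by linarith [hc.1]) (by linarith [hc.2])
  obtain ⟨z, hz0, hz⟩ := hPL.exists_eq_forall_mem_Icc_hasDerivWithinAt₀
  have hz0 : z c = z₀ := hz0
  have hzc : ContinuousOn z (Icc p q) := fun t ht => (hz t ht).continuousWithinAt
  have hzd : ∀ t ∈ Ioo p q, HasDerivAt z (F t (z t)) t := fun t ht =>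
    (hz t (Ioo_subset_Icc_self ht)).hasDerivAt (Icc_mem_nhds ht.1 ht.2)
  have right : ∀ t ∈ Icc c q, ‖z t‖ ≤ R := by
    intro t ht
    have := norm_le_gronwallBound_of_norm_deriv_right_le (f := z) (f' := fun t => F t (z t))
      (δ := ‖z₀‖) (K := K) (ε := 0) (a := c) (b := q) (hzc.mono (Icc_subset_Icc_left hc.1.le))
      (fun s hs => (hzd s ⟨hc.1.trans_le hs.1, hs.2⟩).hasDerivWithinAt) (by rw [hz0])
      (fun s hs => by rw [add_zero]; exact hFb s ⟨hc.1.le.trans hs.1, hs.2.le⟩ _) t ht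
    rw [gronwallBound_ε0] at this
    refine this.trans ?_
    rw [hRdef]
    gcongr
    · exact ht.2
    · exact hc.1.le
  have left : ∀ t ∈ Icc p c, ‖z t‖ ≤ R := by
    intro t ht
    have := norm_le_gronwallBound_of_norm_deriv_right_le (f := fun s => z (-s))
      (f' := fun t => -F (-t) (z (-t)))
      (δ := ‖z₀‖) (K := K) (ε := 0) (a := -c) (b := -p)
      (hzc.comp continuousOn_neg (fun s hs => ⟨by linarith [hs.2], by linarith [hs.1, hc.2]⟩))
      (fun s hs => by
        have h := hzd (-s) ⟨by linarith [hs.2], by linarith [hs.1, hc.2]⟩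
        have h' := h.scomp s (hasDerivAt_neg s)
        simpa [Function.comp_def] using h'.hasDerivWithinAt)
      (by simp [hz0])
      (fun s hs => by
        rw [add_zero, norm_neg]
        exact hFb (-s) ⟨by linarith [hs.2], by linarith [hs.1, hc.2]⟩ _) (-t)
        ⟨by linarith [ht.2], by linarith [ht.1]⟩
    rw [gronwallBound_ε0, neg_neg] at this
    refine this.trans ?_
    rw [hRdef]
    have hle : -t - -c ≤ q - p := by linarith [ht.1, hc.2]
    exact mul_le_mul_of_nonneg_left
      (Real.exp_le_exp.2 (mul_le_mul_of_nonneg_left hle K.2)) (norm_nonneg _)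
  refine ⟨z, hz0, fun t ht => ?_⟩
  have hb : ‖z t‖ ≤ R := by
    rcases le_total t c with h | h
    · exact left t ⟨ht.1.le, h⟩
    · exact right t ⟨h, ht.2.le⟩
  have := hzd t ht
  rwa [hF, show (fun t z => odeV a₁ a₂ t (clampV R z)) t (z t) = odeV a₁ a₂ t (z t) by
    simp only [cl4 _ hb]] at this

lemma exists_global_sol {a₁ a₂ : ℝ → ℝ} {a b c : ℝ} (h1 : ContinuousOn a₁ (Ioo a b))
    (h2 : ContinuousOn a₂ (Ioo a b)) (hc : c ∈ Ioo a b) (z₀ : ℝ × ℝ) :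
    ∃ z : ℝ → ℝ × ℝ, z c = z₀ ∧ ∀ t ∈ Ioo a b, HasDerivAt z (odeV a₁ a₂ t (z t)) t := by
  obtain ⟨hac, hcb⟩ := hc
  set p : ℝ → ℝ := fun t => (a + min t c) / 2 with hp
  set q : ℝ → ℝ := fun t => (b + max t c) / 2 with hq
  have hprop : ∀ t ∈ Ioo a b, a < p t ∧ p t < t ∧ p t < c ∧ t < q t ∧ c < q t ∧ q t < b := by
    intro t ht
    have := lt_min ht.1 hac
    have := max_lt ht.2 hcb
    have := min_le_left t c
    have := min_le_right t c
    have := le_max_left t c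
    have := le_max_right t c
    simp only [hp, hq]
    refine ⟨?_, ?_, ?_, ?_, ?_, ?_⟩ <;> linarith
  have hex : ∀ t, ∃ z : ℝ → ℝ × ℝ, t ∈ Ioo a b → z c = z₀ ∧
      ∀ s ∈ Ioo (p t) (q t), HasDerivAt z (odeV a₁ a₂ s (z s)) s := by
    intro t
    by_cases ht : t ∈ Ioo a b
    · obtain ⟨x1, x2, x3, x4, x5, x6⟩ := hprop t ht
      have hsub : Icc (p t) (q t) ⊆ Ioo a b := Icc_subset_Ioo x1 x6
      obtain ⟨z, hz⟩ := exists_compact_sol (h1.mono hsub) (h2.mono hsub) ⟨x3, x5⟩ z₀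
      exact ⟨z, fun _ => hz⟩
    · exact ⟨fun _ => 0, fun h => absurd h ht⟩
  choose Z hZ using hex
  refine ⟨fun t => Z t t, (hZ c ⟨hac, hcb⟩).1, fun t ht => ?_⟩
  obtain ⟨x1, x2, x3, x4, x5, x6⟩ := hprop t ht
  have hev : (fun s => Z s s) =ᶠ[𝓝 t] Z t := by
    filter_upwards [Ioo_mem_nhds x2 x4] with s hs
    have hs' : s ∈ Ioo a b := ⟨x1.trans hs.1, hs.2.trans x6⟩
    obtain ⟨y1, y2, y3, y4, y5, y6⟩ := hprop s hs'
    have hsub : Icc (max (p s) (p t)) (min (q s) (q t)) ⊆ Ioo a b :=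
      Icc_subset_Ioo (lt_max_of_lt_left y1) (min_lt_of_left_lt y6)
    refine odeV_uniq (c := c) (h1.mono hsub) (h2.mono hsub) ⟨max_lt y3 x3, lt_min y5 x5⟩
      (fun r hr => (hZ s hs').2 r ?_) (fun r hr => (hZ t ht).2 r ?_)
      ((hZ s hs').1.trans (hZ t ht).1.symm) ⟨max_lt y2 hs.1, lt_min y4 hs.2⟩
    · exact ⟨(le_max_left _ _).trans_lt hr.1, hr.2.trans_le (min_le_left _ _)⟩
    · exact ⟨(le_max_right _ _).trans_lt hr.1, hr.2.trans_le (min_le_right _ _)⟩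
  exact ((hZ t ht).2 t ⟨x2, x4⟩).congr_of_eventuallyEq hev

lemma ode_sol_unique {a₁ a₂ : ℝ → ℝ} {a b s : ℝ} (h1 : ContinuousOn a₁ (Ioo a b))
    (h2 : ContinuousOn a₂ (Ioo a b)) (hs : s ∈ Ioo a b) {x : ℝ → ℝ}
    (hx : AnalyticOnNhd ℝ x (Ioo a b))
    (ho : ∀ t ∈ Ioo a b, deriv (deriv x) t + a₁ t * deriv x t + a₂ t * x t = 0)
    (h0 : x s = 0) (h0' : deriv x s = 0) : ∀ t ∈ Ioo a b, x t = 0 := by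
  intro t ht
  have k1 := lt_min ht.1 hs.1
  have k2 := max_lt ht.2 hs.2
  have k3 := min_le_left t s
  have k4 := min_le_right t s
  have k5 := le_max_left t s
  have k6 := le_max_right t s
  have hsub : Icc ((a + min t s) / 2) ((b + max t s) / 2) ⊆ Ioo a b :=
    Icc_subset_Ioo (by linarith) (by linarith)
  have hsub' := Ioo_subset_Icc_self.trans hsub
  have := odeV_uniq (z := fun t => (x t, deriv x t)) (w := fun _ => (0, 0)) (c := s)
    (h1.mono hsub) (h2.mono hsub) ⟨by linarith, by linarith⟩
    (fun r hr => by
      have hr' := hsub' hr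
      have e1 := (hx r hr').differentiableAt.hasDerivAt
      have e2 := ((hx r hr').deriv).differentiableAt.hasDerivAt
      have e3 := e1.prodMk e2
      have e4 : odeV a₁ a₂ r (x r, deriv x r) = (deriv x r, deriv (deriv x) r) := by
        simp only [odeV, Prod.mk.injEq, true_and]
        linarith [ho r hr']
      simpa only [e4] using e3)
    (fun r hr => by
      have e4 : odeV a₁ a₂ r (0, 0) = 0 := by
        ext <;> simp [odeV]
      simp only [e4]
      exact hasDerivAt_const r _)
    (by simp [h0, h0']) (show t ∈ Ioo _ _ from ⟨by linarith, by linarith⟩)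
  exact congrArg Prod.fst this

lemma exists_analytic_sol {a₁ a₂ : ℝ → ℝ} {a b c : ℝ} (h1 : AnalyticOnNhd ℝ a₁ (Ioo a b))
    (h2 : AnalyticOnNhd ℝ a₂ (Ioo a b)) (hc : c ∈ Ioo a b) (α β : ℝ) :
    ∃ x : ℝ → ℝ, AnalyticOnNhd ℝ x (Ioo a b) ∧
      (∀ t ∈ Ioo a b, deriv (deriv x) t + a₁ t * deriv x t + a₂ t * x t = 0) ∧
      x c = α ∧ deriv x c = β := by
  obtain ⟨z, hzc, hz⟩ := exists_global_sol h1.continuousOn h2.continuousOn hc (α, β)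
  have hd1 : ∀ t ∈ Ioo a b, HasDerivAt (fun s => (z s).1) (z t).2 t := fun t ht => (hz t ht).fst
  have hd2 : ∀ t ∈ Ioo a b, HasDerivAt (fun s => (z s).2)
      (-(a₁ t * (z t).2 + a₂ t * (z t).1)) t := fun t ht => (hz t ht).snd
  have hde : ∀ t ∈ Ioo a b, deriv (fun s => (z s).1) t = (z t).2 := fun t ht => (hd1 t ht).deriv
  refine ⟨fun s => (z s).1, fun t ht => ?_, fun t ht => ?_, ?_, ?_⟩
  · obtain ⟨y, hya, hy0, hy1, hyo⟩ := local_sol (h1 t ht) (h2 t ht) (z t).1 (z t).2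
    have hsub : Icc ((a + t) / 2) ((t + b) / 2) ⊆ Ioo a b :=
      Icc_subset_Ioo (by linarith [ht.1]) (by linarith [ht.2])
    obtain ⟨K, hK⟩ := odeV_bound (h1.continuousOn.mono hsub) (h2.continuousOn.mono hsub)
    have heq := ODE_solution_unique_of_eventually (v := odeV a₁ a₂) (s := fun _ => univ) (K := K)
      (f := fun s => (y s, deriv y s)) (g := z) (t₀ := t)
      (by
        filter_upwards [Icc_mem_nhds (show (a + t) / 2 < t by linarith [ht.1])
          (show t < (t + b) / 2 by linarith [ht.2])] with s hs
        exact (odeV_lip (hK s hs)).lipschitzOnWith)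
      (by
        filter_upwards [hya.eventually_analyticAt, hyo] with r hr hro
        refine ⟨?_, trivial⟩
        have e3 := hr.differentiableAt.hasDerivAt.prodMk hr.deriv.differentiableAt.hasDerivAt
        have e4 : odeV a₁ a₂ r (y r, deriv y r) = (deriv y r, deriv (deriv y) r) := by
          simp only [odeV, Prod.mk.injEq, true_and]
          linarith [hro]
        simpa only [e4] using e3)
      (by
        filter_upwards [isOpen_Ioo.mem_nhds ht] with r hr
        exact ⟨hz r hr, trivial⟩)
      (by simp only [hy0, hy1])
    exact hya.congr (heq.mono fun s hs => congrArg Prod.fst hs)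
  · have hev : deriv (fun s => (z s).1) =ᶠ[𝓝 t] fun s => (z s).2 := by
      filter_upwards [isOpen_Ioo.mem_nhds ht] with r hr
      exact hde r hr
    rw [hev.deriv_eq, (hd2 t ht).deriv, hde t ht]
    ring
  · simp [hzc]
  · rw [hde c hc, hzc]

lemma zeros_le_one {f : ℝ → ℝ} {s : Set ℝ} (h1 : ∀ x ∈ s, f x = 0 → deriv f x = 0 → False)
    (h2 : ∀ x ∈ s, ∀ y ∈ s, f x = 0 → f y = 0 → x = y) : ZerosWithMultAtMost f s 1 := by
  intro t m ht hm
  have hz : ∀ x ∈ t, f x = 0 := fun x hx => by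
    simpa using (hm x hx).2 0 (by have := (hm x hx).1; omega)
  have hm1 : ∀ x ∈ t, m x ≤ 1 := fun x hx => by
    by_contra hcon
    exact h1 x (ht hx) (hz x hx) (by simpa using (hm x hx).2 1 (by omega))
  calc t.sum m ≤ t.card • 1 := Finset.sum_le_card_nsmul _ _ _ hm1
    _ ≤ 1 := by
      simpa using Finset.card_le_one.2 fun x hx y hy =>
        h2 x (ht hx) y (ht hy) (hz x hx) (hz y hy)

lemma ZerosWithMultAtMost.simple {f : ℝ → ℝ} {s : Set ℝ} (h : ZerosWithMultAtMost f s 1)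
    {x : ℝ} (hx : x ∈ s) (h0 : f x = 0) : deriv f x ≠ 0 := by
  intro h1
  have := h {x} (fun _ => 2) (by simpa using hx) (by
    intro y hy
    rw [Finset.mem_singleton] at hy
    subst hy
    refine ⟨by norm_num, fun k hk => ?_⟩
    interval_cases k
    · simpa using h0
    · simpa using h1)
  simp at this

lemma ZerosWithMultAtMost.uniq {f : ℝ → ℝ} {s : Set ℝ} (h : ZerosWithMultAtMost f s 1)
    {x y : ℝ} (hx : x ∈ s) (hy : y ∈ s) (h0 : f x = 0) (h1 : f y = 0) : x = y := by
  by_contra hne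
  have := h {x, y} (fun _ => 1) (by
      intro w hw
      simp only [Finset.coe_insert, Finset.coe_singleton, mem_insert_iff, mem_singleton_iff] at hw
      rcases hw with rfl | rfl <;> assumption) (by
    intro w hw
    simp only [Finset.mem_insert, Finset.mem_singleton] at hw
    refine ⟨le_rfl, fun k hk => ?_⟩
    interval_cases k
    rcases hw with rfl | rfl <;> simpa)
  rw [Finset.sum_const, Finset.card_pair hne] at this
  simp at this

lemma ode_lin {a₁ a₂ : ℝ → ℝ} {a b : ℝ} {x y : ℝ → ℝ}
    (hx : AnalyticOnNhd ℝ x (Ioo a b))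
    (ho : ∀ t ∈ Ioo a b, deriv (deriv x) t + a₁ t * deriv x t + a₂ t * x t = 0)
    (hy : AnalyticOnNhd ℝ y (Ioo a b))
    (hoy : ∀ t ∈ Ioo a b, deriv (deriv y) t + a₁ t * deriv y t + a₂ t * y t = 0) (k : ℝ) :
    AnalyticOnNhd ℝ (fun t => x t - k * y t) (Ioo a b) ∧
    (∀ t ∈ Ioo a b, deriv (fun t => x t - k * y t) t = deriv x t - k * deriv y t) ∧
    ∀ t ∈ Ioo a b, deriv (deriv (fun t => x t - k * y t)) t +
      a₁ t * deriv (fun t => x t - k * y t) t + a₂ t * (x t - k * y t) = 0 := by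
  have hd : ∀ t ∈ Ioo a b, deriv (fun t => x t - k * y t) t = deriv x t - k * deriv y t :=
    fun t ht => ((hx t ht).differentiableAt.hasDerivAt.sub
      ((hy t ht).differentiableAt.hasDerivAt.const_mul k)).deriv
  refine ⟨fun t ht => (hx t ht).fun_sub (analyticAt_const.fun_mul (hy t ht)), hd, fun t ht => ?_⟩
  have hev : deriv (fun t => x t - k * y t) =ᶠ[𝓝 t] fun t => deriv x t - k * deriv y t := by
    filter_upwards [isOpen_Ioo.mem_nhds ht] with r hr
    exact hd r hr
  have hdd : deriv (fun t => deriv x t - k * deriv y t) t =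
      deriv (deriv x) t - k * deriv (deriv y) t :=
    ((hx t ht).deriv.differentiableAt.hasDerivAt.sub
      ((hy t ht).deriv.differentiableAt.hasDerivAt.const_mul k)).deriv
  rw [hev.deriv_eq, hdd, hd t ht]
  linear_combination ho t ht - k * hoy t ht

lemma sign_of_simple_zero {u : ℝ → ℝ} {a b c : ℝ} (hu : ContinuousOn u (Ioo a b))
    (hc : c ∈ Ioo a b) (h0 : u c = 0) (h1 : deriv u c = 1)
    (hne : ∀ t ∈ Ioo a b, u t = 0 → t = c) :
    (∀ t ∈ Ioo c b, 0 < u t) ∧ ∀ t ∈ Ioo a c, u t < 0 := by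
  have hd : HasDerivAt u 1 c := by
    rw [← h1]
    exact (differentiableAt_of_deriv_ne_zero (by rw [h1]; norm_num)).hasDerivAt
  have hsl := hasDerivAt_iff_tendsto_slope.1 hd
  have hpos : ∀ᶠ t in 𝓝[≠] c, 0 < slope u c t := hsl.eventually (lt_mem_nhds one_pos)
  constructor
  · obtain ⟨r, ⟨hr1, hr2⟩, hr⟩ : ∃ r, r ∈ Ioo c b ∧ 0 < u r := by
      have e1 : ∀ᶠ t in 𝓝[>] c, 0 < slope u c t :=
        hpos.filter_mono (nhdsWithin_mono _ fun x hx => ne_of_gt hx)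
      obtain ⟨r, hr, hr'⟩ := (e1.and (Ioo_mem_nhdsGT hc.2)).exists
      refine ⟨r, hr', ?_⟩
      rw [slope_def_field, h0, sub_zero] at hr
      exact (div_pos_iff_of_pos_right (sub_pos.2 hr'.1)).1 hr
    intro t ht
    by_contra hcon
    push Not at hcon
    have hsub : uIcc t r ⊆ Ioo c b := by
      intro w hw
      rw [mem_uIcc] at hw
      rcases hw with hw | hw
      · exact ⟨ht.1.trans_le hw.1, hw.2.trans_lt hr2⟩
      · exact ⟨hr1.trans_le hw.1, hw.2.trans_lt ht.2⟩
    have hsub' : Ioo c b ⊆ Ioo a b := Ioo_subset_Ioo_left hc.1.le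
    obtain ⟨w, hw, hw0⟩ := intermediate_value_uIcc (hu.mono (hsub.trans hsub'))
      (show (0:ℝ) ∈ uIcc (u t) (u r) from mem_uIcc.2 (Or.inl ⟨hcon, hr.le⟩))
    exact (hsub hw).1.ne' (hne w (hsub' (hsub hw)) hw0)
  · obtain ⟨r, ⟨hr1, hr2⟩, hr⟩ : ∃ r, r ∈ Ioo a c ∧ u r < 0 := by
      have e1 : ∀ᶠ t in 𝓝[<] c, 0 < slope u c t :=
        hpos.filter_mono (nhdsWithin_mono _ fun x hx => ne_of_lt hx)
      obtain ⟨r, hr, hr'⟩ := (e1.and (Ioo_mem_nhdsLT hc.1)).exists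
      refine ⟨r, hr', ?_⟩
      rw [slope_def_field, h0, sub_zero] at hr
      by_contra hcon
      push Not at hcon
      exact absurd hr (not_lt.2 (div_nonpos_of_nonneg_of_nonpos hcon (sub_neg.2 hr'.2).le))
    intro t ht
    by_contra hcon
    push Not at hcon
    have hsub : uIcc t r ⊆ Ioo a c := by
      intro w hw
      rw [mem_uIcc] at hw
      rcases hw with hw | hw
      · exact ⟨ht.1.trans_le hw.1, hw.2.trans_lt hr2⟩
      · exact ⟨hr1.trans_le hw.1, hw.2.trans_lt ht.2⟩
    have hsub' : Ioo a c ⊆ Ioo a b := Ioo_subset_Ioo_right hc.2.le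
    obtain ⟨w, hw, hw0⟩ := intermediate_value_uIcc (hu.mono (hsub.trans hsub'))
      (show (0:ℝ) ∈ uIcc (u t) (u r) from mem_uIcc.2 (Or.inr ⟨hr.le, hcon⟩))
    exact (hsub hw).2.ne (hne w (hsub' (hsub hw)) hw0)

/-- Proposition 3.1 (Gavrilov–Iliev): the solution space of the analytic linear ODE
`x'' + a₁ x' + a₂ x = 0` on the open interval `(a,b)` is a Chebyshev space (every
nonzero solution has at most one zero counted with multiplicity) if and only if there
is a nowhere-vanishing solution `x₀`. -/
theorem chebyshev_iff_nonvanishing_solution (a b : ℝ) (hab : a < b) (a₁ a₂ : ℝ → ℝ)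
    (ha₁ : AnalyticOnNhd ℝ a₁ (Set.Ioo a b))
    (ha₂ : AnalyticOnNhd ℝ a₂ (Set.Ioo a b)) :
    (∀ x : ℝ → ℝ, AnalyticOnNhd ℝ x (Set.Ioo a b) →
      (∀ t ∈ Set.Ioo a b,
        deriv (deriv x) t + a₁ t * deriv x t + a₂ t * x t = 0) →
      (∃ t ∈ Set.Ioo a b, x t ≠ 0) →
      ZerosWithMultAtMost x (Set.Ioo a b) 1)
    ↔ (∃ x₀ : ℝ → ℝ, AnalyticOnNhd ℝ x₀ (Set.Ioo a b) ∧
        (∀ t ∈ Set.Ioo a b,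
          deriv (deriv x₀) t + a₁ t * deriv x₀ t + a₂ t * x₀ t = 0) ∧
        ∀ t ∈ Set.Ioo a b, x₀ t ≠ 0) := by
  constructor
  · intro H
    obtain ⟨c, hc⟩ : ∃ c, c ∈ Ioo a b := nonempty_Ioo.2 hab
    obtain ⟨u, hua, huo, hu0, hu1⟩ := exists_analytic_sol ha₁ ha₂ hc 0 1
    obtain ⟨v, hva, hvo, hv0, hv1⟩ := exists_analytic_sol ha₁ ha₂ hc 1 0
    have hune : ∃ t ∈ Ioo a b, u t ≠ 0 := by
      by_contra hcon
      push Not at hcon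
      have : u =ᶠ[𝓝 c] fun _ => 0 := by
        filter_upwards [isOpen_Ioo.mem_nhds hc] with r hr using hcon r hr
      rw [this.deriv_eq] at hu1
      simp at hu1
    have hHu := H u hua huo hune
    obtain ⟨hup, hun⟩ := sign_of_simple_zero hua.continuousOn hc hu0 hu1
      (fun t ht h => hHu.uniq ht hc h hu0)
    have hHk : ∀ k : ℝ, ZerosWithMultAtMost (fun t => v t - k * u t) (Ioo a b) 1 := fun k => by
      obtain ⟨e1, e2, e3⟩ := ode_lin hva hvo hua huo k
      exact H _ e1 e3 ⟨c, hc, by simp [hv0, hu0]⟩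
    have hlr : ∀ s ∈ Ioo a c, ∀ t ∈ Ioo c b, v s / u s ≤ v t / u t := by
      intro s hs t ht
      by_contra hcon
      push Not at hcon
      set k := v s / u s with hk
      have hs' : s ∈ Ioo a b := ⟨hs.1, hs.2.trans hc.2⟩
      have ht' : t ∈ Ioo a b := ⟨hc.1.trans ht.1, ht.2⟩
      have z1 : v s - k * u s = 0 := by
        rw [hk, div_mul_cancel₀ _ (hun s hs).ne, sub_self]
      have z2 : v t - k * u t ≤ 0 := by
        rw [div_lt_iff₀ (hup t ht)] at hcon
        linarith
      have hcont := (ode_lin hva hvo hua huo k).1.continuousOn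
      obtain ⟨w, hw, hw0⟩ := intermediate_value_Icc' (f := fun t => v t - k * u t) ht.1.le
        (hcont.mono (Icc_subset_Ioo hc.1 ht.2))
        (show (0:ℝ) ∈ Icc _ _ from ⟨z2, by simp [hv0, hu0]⟩)
      have := (hHk k).uniq hs' (⟨hc.1.trans_le hw.1, hw.2.trans_lt ht.2⟩) z1 hw0
      linarith [hs.2, hw.1]
    obtain ⟨s₀, hs₀⟩ : ∃ s, s ∈ Ioo a c := nonempty_Ioo.2 hc.1
    obtain ⟨t₀, ht₀⟩ : ∃ s, s ∈ Ioo c b := nonempty_Ioo.2 hc.2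
    set S := (fun s => v s / u s) '' Ioo a c with hS
    have hSne : S.Nonempty := ⟨_, s₀, hs₀, rfl⟩
    have hSb : BddAbove S := ⟨v t₀ / u t₀, by
      rintro _ ⟨s, hs, rfl⟩
      exact hlr s hs t₀ ht₀⟩
    set L := sSup S with hL
    obtain ⟨e1, e2, e3⟩ := ode_lin hva hvo hua huo L
    have hnn : ∀ t ∈ Ioo a b, 0 ≤ v t - L * u t := by
      intro t ht
      rcases lt_trichotomy t c with h | h | h
      · have := le_csSup hSb ⟨t, ⟨ht.1, h⟩, rfl⟩
        have h' : v t / u t ≤ L := this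
        rw [div_le_iff_of_neg (hun t ⟨ht.1, h⟩)] at h'
        linarith
      · rw [h]; simp [hv0, hu0]
      · have h' : L ≤ v t / u t := csSup_le hSne (by
          rintro _ ⟨s, hs, rfl⟩
          exact hlr s hs t ⟨h, ht.2⟩)
        rw [le_div_iff₀ (hup t ⟨h, ht.2⟩)] at h'
        linarith
    refine ⟨_, e1, e3, fun t ht h0 => ?_⟩
    have hmin : IsLocalMin (fun t => v t - L * u t) t := by
      have h0' : v t - L * u t = 0 := h0
      filter_upwards [isOpen_Ioo.mem_nhds ht] with r hr
      rw [h0']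
      exact hnn r hr
    exact (hHk L).simple ht h0 hmin.deriv_eq_zero
  · rintro ⟨y, hya, hyo, hy0⟩ x hxa hxo ⟨t₁, ht₁, hxt₁⟩
    have huq := fun (s : ℝ) (hs : s ∈ Ioo a b) (w : ℝ → ℝ) =>
      ode_sol_unique (x := w) ha₁.continuousOn ha₂.continuousOn hs
    refine zeros_le_one (fun s hs h0 h1 => hxt₁ (huq s hs x hxa hxo h0 h1 t₁ ht₁)) ?_
    have main : ∀ s ∈ Ioo a b, ∀ t ∈ Ioo a b, x s = 0 → x t = 0 → ¬ s < t := by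
      intro s hs t ht hxs hxt hlt
      have hsub : Icc s t ⊆ Ioo a b := Icc_subset_Ioo hs.1 ht.2
      obtain ⟨r, hr, hr0⟩ := exists_deriv_eq_zero (f := fun t => x t / y t) hlt
        ((hxa.continuousOn.mono hsub).div (hya.continuousOn.mono hsub)
          fun w hw => hy0 w (hsub hw)) (by simp [hxs, hxt])
      have hrI := hsub (Ioo_subset_Icc_self hr)
      have hd := ((hxa r hrI).differentiableAt.hasDerivAt.div
        (hya r hrI).differentiableAt.hasDerivAt (hy0 r hrI)).deriv
      have hd' : deriv (fun t => x t / y t) r =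
        (deriv x r * y r - x r * deriv y r) / y r ^ 2 := hd
      rw [hr0] at hd'
      have hyr := hy0 r hrI
      have hW : deriv x r * y r - x r * deriv y r = 0 := by
        field_simp at hd'
        linarith
      obtain ⟨e1, e2, e3⟩ := ode_lin hxa hxo hya hyo (x r / y r)
      have hz := huq r hrI _ e1 e3 (by field_simp; ring) (by
        rw [e2 r hrI]; field_simp; linarith)
      have hk : x r / y r = 0 := by
        have := hz s hs
        rw [hxs, zero_sub, neg_eq_zero, mul_eq_zero] at this
        exact this.resolve_right (hy0 s hs)
      have := hz t₁ ht₁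
      rw [hk] at this
      exact hxt₁ (by simpa using this)
    intro s hs t ht h0 h1
    exact le_antisymm (not_lt.1 (main t ht s hs h1 h0)) (not_lt.1 (main s hs t ht h0 h1))
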